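/- arXiv:2004.12941 — 5 statements merged into one kernel-verified Lean document; each statement's English description precedes it below -/
import Mathlib

section
/- If G is a deterministic finite simple graph and H is a total finite simple graph, then H ⊨∧ G implies H ⊨∨ G. -/
namespace BGL

variable {V : Type*}

/-- A stable (independent) set: pairwise non-adjacent vertices. -/
def IsStable (G : SimpleGraph V) (T : Set V) : Prop :=
  T.Pairwise fun x y => ¬ G.Adj x y

/-- A maximal clique: a clique not properly contained in any larger clique. -/
def MaxClique (G : SimpleGraph V) (S : Set V) : Prop :=
  G.IsClique S ∧ ∀ S' : Set V, G.IsClique S' → S ⊆ S' → S' = S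

/-- A maximal stable set. -/
def MaxStable (G : SimpleGraph V) (T : Set V) : Prop :=
  IsStable G T ∧ ∀ T' : Set V, IsStable G T' → T ⊆ T' → T' = T

/-- `G(X,1)`: some maximal clique of `G` is contained in `X`. -/
def EvalOne (G : SimpleGraph V) (X : Set V) : Prop :=
  ∃ S, MaxClique G S ∧ S ⊆ X

/-- `G(X,0)`: some maximal stable set of `G` is disjoint from `X`. -/
def EvalZero (G : SimpleGraph V) (X : Set V) : Prop :=
  ∃ T, MaxStable G T ∧ T ∩ X = ∅

/-- Conjunctive entailment `G ⊨∧ H`. -/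
def EntailsAnd (G H : SimpleGraph V) : Prop :=
  ∀ S, MaxClique G S → ∃ S', MaxClique H S' ∧ S' ⊆ S

/-- Disjunctive entailment `G ⊨∨ H`. -/
def EntailsOr (G H : SimpleGraph V) : Prop :=
  ∀ T, MaxStable H T → ∃ T', MaxStable G T' ∧ T' ⊆ T

/-- `G` is deterministic: no assignment evaluates to both 0 and 1. -/
def Deterministic (G : SimpleGraph V) : Prop :=
  ¬ ∃ X : Set V, EvalZero G X ∧ EvalOne G X

/-- `G` is total: every assignment evaluates to 0 or 1. -/
def Total (G : SimpleGraph V) : Prop :=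
  ∀ X : Set V, EvalZero G X ∨ EvalOne G X

/-- `G` is CIS: every maximal clique and maximal stable set intersect. -/
def CIS (G : SimpleGraph V) : Prop :=
  ∀ S T : Set V, MaxClique G S → MaxStable G T → (S ∩ T).Nonempty

/-- A maximal clique within the vertex set `U`. -/
def MaxCliqueOn (G : SimpleGraph V) (U S : Set V) : Prop :=
  S ⊆ U ∧ G.IsClique S ∧ ∀ S' : Set V, S' ⊆ U → G.IsClique S' → S ⊆ S' → S' = S

/-- A maximal stable set within the vertex set `U`. -/
def MaxStableOn (G : SimpleGraph V) (U T : Set V) : Prop :=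
  T ⊆ U ∧ IsStable G T ∧ ∀ T' : Set V, T' ⊆ U → IsStable G T' → T ⊆ T' → T' = T

/-- `M` is a module of `G`: every outside vertex treats all of `M` uniformly. -/
def IsModule (G : SimpleGraph V) (M : Set V) : Prop :=
  ∀ z ∉ M, ∀ x ∈ M, ∀ y ∈ M, (G.Adj z x ↔ G.Adj z y)

/-- The quotient graph of `G` by a (modular) partition `P`: parts are adjacent iff
some (equivalently, for modules, every) pair of their vertices is adjacent. -/
def QuotGraph (G : SimpleGraph V) (P : Set (Set V)) : SimpleGraph {M // M ∈ P} :=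
  SimpleGraph.fromRel fun M N => ∃ x ∈ M.1, ∃ y ∈ N.1, G.Adj x y

/-- If `G` is deterministic and `H` is total, `H ⊨∧ G` implies `H ⊨∨ G`. -/
theorem entailsAnd_imp_entailsOr {V : Type*} [Fintype V] (G H : SimpleGraph V)
    (hG : Deterministic G) (hH : Total H) (h : EntailsAnd H G) :
    EntailsOr H G := by
  intro T hT
  rcases hH Tᶜ with ⟨T', hT', hdisj⟩ | ⟨S, hS, hST⟩
  · refine ⟨T', hT', ?_⟩
    rwa [← Set.sdiff_eq, Set.sdiff_eq_empty] at hdisj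
  · obtain ⟨S', hS', hsub⟩ := h S hS
    exact absurd ⟨Tᶜ, ⟨T, hT, Set.inter_compl_self T⟩, ⟨S', hS', hsub.trans hST⟩⟩ hG

end BGL
end

section
/- Let G be a finite simple graph that is total and CIS, and let Y ⊆ V(G) be a set that is not a clique. Then every selection with respect to Y is a covering; that is, for every family (T_x)_{x∈Y} of maximal stable sets of G with T_x ∩ Y = {x} for each x ∈ Y, there exists a maximal stable set D of G with D ⊆ ⋃_{x∈Y} T_x and D ∩ Y = ∅. -/
namespace BGL

variable {V : Type*}

/-- In a total CIS graph, every selection with respect to a non-clique is a covering. -/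
theorem selection_is_covering {V : Type*} [Fintype V] (G : SimpleGraph V)
    (htot : Total G) (hcis : CIS G) (Y : Set V) (hY : ¬ G.IsClique Y)
    (T : V → Set V) (hsel : ∀ x ∈ Y, MaxStable G (T x) ∧ T x ∩ Y = {x}) :
    ∃ D : Set V, MaxStable G D ∧ (D ⊆ ⋃ x ∈ Y, T x) ∧ D ∩ Y = ∅ := by
  rcases htot (Y ∪ (⋃ x ∈ Y, T x)ᶜ) with ⟨D, hD, hdisj⟩ | ⟨S, hS, hSX⟩
  · rw [← Set.disjoint_iff_inter_eq_empty, Set.disjoint_union_right,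
      Set.disjoint_compl_right_iff_subset] at hdisj
    exact ⟨D, hD, hdisj.2, hdisj.1.inter_eq⟩
  · refine absurd (hS.1.subset fun x hx => ?_) hY
    obtain ⟨z, hzS, hzT⟩ := hcis S (T x) hS (hsel x hx).1
    have hzY : z ∈ Y := (hSX hzS).resolve_right fun h => h (Set.mem_biUnion hx hzT)
    have hzx : z ∈ ({x} : Set V) := (hsel x hx).2 ▸ ⟨hzT, hzY⟩
    exact Set.mem_singleton_iff.1 hzx ▸ hzS

end BGL
end

section
/- For any linear (read-once) positive Boolean formula A: (1) a set S of variables is a minterm of the monotone Boolean function computed by A if and only if S is a maximal clique of the relation web W(A); (2) a set T of variables is a maxterm of the function computed by A if and only if T is a maximal stable set of W(A). -/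
namespace BGL

/-- Positive Boolean formulas over variables in `V`. -/
inductive PBF (V : Type*) : Type _
  | var : V → PBF V
  | or  : PBF V → PBF V → PBF V
  | and : PBF V → PBF V → PBF V

namespace PBF

variable {V : Type*} [DecidableEq V]

/-- The (finite) set of variables occurring in a formula. -/
def vars : PBF V → Finset V
  | .var x => {x}
  | .or A B => A.vars ∪ B.vars
  | .and A B => A.vars ∪ B.vars

/-- A formula is linear (read-once) if each variable occurs at most once in it. -/
def Linear : PBF V → Prop
  | .var _ => True
  | .or A B => A.Linear ∧ B.Linear ∧ Disjoint A.vars B.vars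
  | .and A B => A.Linear ∧ B.Linear ∧ Disjoint A.vars B.vars

/-- Evaluation of a formula on an assignment `X ⊆ V`. -/
def eval (X : Set V) : PBF V → Prop
  | .var x => x ∈ X
  | .or A B => A.eval X ∨ B.eval X
  | .and A B => A.eval X ∧ B.eval X

/-- `x` and `y` are distinct variables of `A` whose least common connective is `∧`. -/
def webAdj : PBF V → V → V → Prop
  | .var _, _, _ => False
  | .or A B, x, y => A.webAdj x y ∨ B.webAdj x y
  | .and A B, x, y => A.webAdj x y ∨ B.webAdj x y ∨
      (x ∈ A.vars ∧ y ∈ B.vars) ∨ (x ∈ B.vars ∧ y ∈ A.vars)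

/-- The relation web of a formula: the graph on its variables with an edge between
two variables iff their least common connective is `∧`. -/
def web (A : PBF V) : SimpleGraph V := SimpleGraph.fromRel A.webAdj

/-- Equivalence of formulas modulo associativity and commutativity of `∨` and `∧`:
the smallest congruence containing the AC equations. -/
inductive AC : PBF V → PBF V → Prop
  | refl (A : PBF V) : AC A A
  | symm {A B : PBF V} : AC A B → AC B A
  | trans {A B C : PBF V} : AC A B → AC B C → AC A C
  | orComm (A B : PBF V) : AC (.or A B) (.or B A)
  | andComm (A B : PBF V) : AC (.and A B) (.and B A)
  | orAssoc (A B C : PBF V) : AC (.or A (.or B C)) (.or (.or A B) C)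
  | andAssoc (A B C : PBF V) : AC (.and A (.and B C)) (.and (.and A B) C)
  | orCongr {A A' B B' : PBF V} : AC A A' → AC B B' → AC (.or A B) (.or A' B')
  | andCongr {A A' B B' : PBF V} : AC A A' → AC B B' → AC (.and A B) (.and A' B')

/-- A minterm of `A`: a minimal set of variables on which `A` evaluates to `1`. -/
def Minterm (A : PBF V) (S : Set V) : Prop :=
  A.eval S ∧ ∀ S' ⊆ S, A.eval S' → S' = S

/-- A maxterm of `A`: a minimal set of variables `T` such that `A` evaluates to `0`
on the complement of `T` within the variables of `A`. -/
def Maxterm (A : PBF V) (T : Set V) : Prop :=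
  ¬ A.eval (↑A.vars \ T) ∧ ∀ T' ⊆ T, ¬ A.eval (↑A.vars \ T') → T' = T

end PBF

variable {V : Type*}

namespace PBF

variable {V : Type*} [DecidableEq V]

/-- The De Morgan dual of a formula, exchanging `∨` and `∧`. -/
def dual : PBF V → PBF V
  | .var x => .var x
  | .or A B => .and A.dual B.dual
  | .and A B => .or A.dual B.dual

theorem vars_dual (A : PBF V) : A.dual.vars = A.vars := by
  induction A <;> simp_all [dual, vars]

theorem Linear.dual {A : PBF V} (hA : A.Linear) : A.dual.Linear := by
  induction A <;> simp_all [PBF.dual, Linear, vars_dual]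

theorem eval_mono {W : Type*} {A : PBF W} {X Y : Set W} (h : X ⊆ Y) (hX : A.eval X) : A.eval Y := by
  induction A with
  | var x => exact h hX
  | or A B ihA ihB => exact hX.imp ihA ihB
  | and A B ihA ihB => exact hX.imp ihA ihB

theorem eval_congr {A : PBF V} {X Y : Set V} (h : ∀ x ∈ A.vars, x ∈ X ↔ x ∈ Y) :
    A.eval X ↔ A.eval Y := by
  induction A with
  | var x => simpa [eval, vars] using h
  | or A B ihA ihB =>
    simp only [vars, Finset.mem_union] at h
    exact or_congr (ihA fun x hx => h x (.inl hx)) (ihB fun x hx => h x (.inr hx))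
  | and A B ihA ihB =>
    simp only [vars, Finset.mem_union] at h
    exact and_congr (ihA fun x hx => h x (.inl hx)) (ihB fun x hx => h x (.inr hx))

theorem eval_inter_vars {A : PBF V} {X : Set V} : A.eval (X ∩ ↑A.vars) ↔ A.eval X :=
  eval_congr fun x hx => by simp [hx]

theorem exists_mem_vars_of_eval {A : PBF V} {X : Set V} (hX : A.eval X) :
    ∃ x ∈ A.vars, x ∈ X := by
  induction A with
  | var x => exact ⟨x, by simp [vars], hX⟩
  | or A B ihA ihB =>
    rcases hX with h | h
    · obtain ⟨x, hx, hxX⟩ := ihA h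
      exact ⟨x, by simp [vars, hx], hxX⟩
    · obtain ⟨x, hx, hxX⟩ := ihB h
      exact ⟨x, by simp [vars, hx], hxX⟩
  | and A B ihA ihB =>
    obtain ⟨x, hx, hxX⟩ := ihA hX.1
    exact ⟨x, by simp [vars, hx], hxX⟩

theorem eval_dual (A : PBF V) (X : Set V) : A.dual.eval X ↔ ¬ A.eval (↑A.vars \ X) := by
  induction A with
  | var x => simp [dual, eval, vars]
  | or A B ihA ihB =>
    rw [eval, not_or]
    refine and_congr (ihA.trans (not_congr (eval_congr ?_)))
      (ihB.trans (not_congr (eval_congr ?_))) <;> simp +contextual [vars]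
  | and A B ihA ihB =>
    rw [eval, not_and_or]
    refine or_congr (ihA.trans (not_congr (eval_congr ?_)))
      (ihB.trans (not_congr (eval_congr ?_))) <;> simp +contextual [vars]

theorem minterm_dual_iff {A : PBF V} {T : Set V} : A.dual.Minterm T ↔ A.Maxterm T := by
  simp only [Minterm, Maxterm, eval_dual]

theorem mem_vars_of_webAdj {A : PBF V} {x y : V} (h : A.webAdj x y) :
    x ∈ A.vars ∧ y ∈ A.vars := by
  induction A with
  | var => exact h.elim
  | or A B ihA ihB => simp only [webAdj, vars, Finset.mem_union] at *; tauto
  | and A B ihA ihB => simp only [webAdj, vars, Finset.mem_union] at *; tauto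

theorem mem_vars_of_web_adj {A : PBF V} {x y : V} (h : A.web.Adj x y) :
    x ∈ A.vars ∧ y ∈ A.vars := by
  rw [web, SimpleGraph.fromRel_adj] at h
  exact h.2.elim mem_vars_of_webAdj fun h => (mem_vars_of_webAdj h).symm

theorem web_var_adj {v x y : V} : ¬ (PBF.var v).web.Adj x y := by
  simp [web, webAdj]

theorem web_or_adj {A B : PBF V} {x y : V} :
    (PBF.or A B).web.Adj x y ↔ A.web.Adj x y ∨ B.web.Adj x y := by
  simp only [web, SimpleGraph.fromRel_adj, webAdj]
  tauto

theorem web_and_adj {A B : PBF V} (hAB : Disjoint A.vars B.vars) {x y : V} :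
    (PBF.and A B).web.Adj x y ↔ A.web.Adj x y ∨ B.web.Adj x y ∨
      (x ∈ A.vars ∧ y ∈ B.vars) ∨ (x ∈ B.vars ∧ y ∈ A.vars) := by
  have hne : ∀ {a b}, a ∈ A.vars → b ∈ B.vars → a ≠ b :=
    fun ha hb h => Finset.disjoint_left.1 hAB ha (h ▸ hb)
  have h₁ := @hne x y
  have h₂ := @hne y x
  simp only [web, SimpleGraph.fromRel_adj, webAdj]
  grind

theorem web_dual_adj {A : PBF V} (hA : A.Linear) {x y : V} (hx : x ∈ A.vars)
    (hy : y ∈ A.vars) (hxy : x ≠ y) : A.dual.web.Adj x y ↔ ¬ A.web.Adj x y := by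
  induction A with
  | var => simp_all [vars]
  | or A B ihA ihB =>
    obtain ⟨hA, hB, hAB⟩ := hA
    have hd := Finset.disjoint_left.1 hAB
    have hAB' : Disjoint A.dual.vars B.dual.vars := by rwa [vars_dual, vars_dual]
    have h₁ := @mem_vars_of_web_adj V _ A x y
    have h₂ := @mem_vars_of_web_adj V _ B x y
    have h₃ := @mem_vars_of_web_adj V _ A.dual x y
    have h₄ := @mem_vars_of_web_adj V _ B.dual x y
    simp only [dual, web_or_adj, web_and_adj hAB', vars_dual, vars, Finset.mem_union] at *
    grind
  | and A B ihA ihB =>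
    obtain ⟨hA, hB, hAB⟩ := hA
    have hd := Finset.disjoint_left.1 hAB
    have h₁ := @mem_vars_of_web_adj V _ A x y
    have h₂ := @mem_vars_of_web_adj V _ B x y
    have h₃ := @mem_vars_of_web_adj V _ A.dual x y
    have h₄ := @mem_vars_of_web_adj V _ B.dual x y
    simp only [dual, web_or_adj, web_and_adj hAB, vars_dual, vars, Finset.mem_union] at *
    grind

theorem isClique_web_dual_iff {A : PBF V} (hA : A.Linear) {T : Set V} (hT : T ⊆ ↑A.vars) :
    A.dual.web.IsClique T ↔ IsStable A.web T :=
  forall₂_congr fun _ hx => forall₃_congr fun _ hy hxy => web_dual_adj hA (hT hx) (hT hy) hxy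

theorem maxCliqueOn_web_dual_iff {A : PBF V} (hA : A.Linear) {T : Set V} :
    MaxCliqueOn A.dual.web ↑A.dual.vars T ↔ MaxStableOn A.web ↑A.vars T := by
  rw [vars_dual]
  refine and_congr_right fun hT => and_congr (isClique_web_dual_iff hA hT) ?_
  exact forall₂_congr fun _ hT' => imp_congr_left (isClique_web_dual_iff hA hT')

theorem isClique_web_or_cases {A B : PBF V} (hAB : Disjoint A.vars B.vars) {S : Set V}
    (hS : S ⊆ ↑(PBF.or A B).vars) (hc : (PBF.or A B).web.IsClique S) :
    (S ⊆ ↑A.vars ∧ A.web.IsClique S) ∨ (S ⊆ ↑B.vars ∧ B.web.IsClique S) := by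
  have hd := Finset.disjoint_left.1 hAB
  have hm : ∀ x ∈ S, x ∈ A.vars ∨ x ∈ B.vars := fun x hx => by simpa [vars] using hS hx
  have hadj : ∀ x ∈ S, ∀ y ∈ S, x ≠ y → A.web.Adj x y ∨ B.web.Adj x y :=
    fun x hx y hy hxy => web_or_adj.1 (hc hx hy hxy)
  by_cases h : ∃ x ∈ S, x ∈ A.vars
  · obtain ⟨x, hxS, hxA⟩ := h
    have hSA : S ⊆ ↑A.vars := fun y hy => by
      by_cases hxy : x = y
      · exact hxy ▸ hxA
      · exact (hadj x hxS y hy hxy).elim (fun h => (mem_vars_of_web_adj h).2)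
          fun h => (hd hxA (mem_vars_of_web_adj h).1).elim
    exact .inl ⟨hSA, fun y hy z hz hyz => (hadj y hy z hz hyz).resolve_right
      fun h => hd (hSA hy) (mem_vars_of_web_adj h).1⟩
  · push Not at h
    exact .inr ⟨fun y hy => (hm y hy).resolve_left (h y hy), fun y hy z hz hyz =>
      (hadj y hy z hz hyz).resolve_left fun h' => h y hy (mem_vars_of_web_adj h').1⟩

theorem isClique_web_and_iff {A B : PBF V} (hAB : Disjoint A.vars B.vars) {S : Set V}
    (hS : S ⊆ ↑(PBF.and A B).vars) :
    (PBF.and A B).web.IsClique S ↔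
      A.web.IsClique (S ∩ ↑A.vars) ∧ B.web.IsClique (S ∩ ↑B.vars) := by
  have hd := Finset.disjoint_left.1 hAB
  have hm : ∀ x ∈ S, x ∈ A.vars ∨ x ∈ B.vars := fun x hx => by simpa [vars] using hS hx
  have h₁ := @mem_vars_of_web_adj V _ A
  have h₂ := @mem_vars_of_web_adj V _ B
  simp only [SimpleGraph.IsClique, Set.Pairwise, web_and_adj hAB, Set.mem_inter_iff,
    SetLike.mem_coe]
  refine ⟨fun h => ⟨?_, ?_⟩, fun h => ?_⟩ <;> grind

theorem isClique_web_and_union {A B : PBF V} (hAB : Disjoint A.vars B.vars) {S T : Set V}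
    (hSA : S ⊆ ↑A.vars) (hTB : T ⊆ ↑B.vars) (hS : A.web.IsClique S) (hT : B.web.IsClique T) :
    (PBF.and A B).web.IsClique (S ∪ T) := by
  have hd : Disjoint (A.vars : Set V) ↑B.vars := Finset.disjoint_coe.2 hAB
  rw [isClique_web_and_iff hAB (by simpa [vars] using Set.union_subset_union hSA hTB)]
  constructor
  · rwa [Set.union_inter_distrib_right, Set.inter_eq_left.2 hSA,
      (hd.symm.mono_left hTB).inter_eq, Set.union_empty]
  · rwa [Set.union_inter_distrib_right, Set.inter_eq_left.2 hTB,
      (hd.mono_left hSA).inter_eq, Set.empty_union]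

/-- Every satisfying assignment contains a satisfying clique. -/
theorem exists_subset_of_isClique_of_eval {A : PBF V} (hA : A.Linear) {X : Set V}
    (hX : A.eval X) : ∃ S ⊆ X, S ⊆ ↑A.vars ∧ A.web.IsClique S ∧ A.eval S := by
  induction A with
  | var x => exact ⟨{x}, by simpa [eval] using hX, by simp [vars], by simp, by simp [eval]⟩
  | or A B ihA ihB =>
    rcases hX with h | h
    · obtain ⟨S, hSX, hSA, hc, he⟩ := ihA hA.1 h
      exact ⟨S, hSX, hSA.trans (by simp [vars]), hc.mono fun _ _ h => web_or_adj.2 (.inl h),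
        .inl he⟩
    · obtain ⟨S, hSX, hSB, hc, he⟩ := ihB hA.2.1 h
      exact ⟨S, hSX, hSB.trans (by simp [vars]), hc.mono fun _ _ h => web_or_adj.2 (.inr h),
        .inr he⟩
  | and A B ihA ihB =>
    obtain ⟨S, hSX, hSA, hSc, hSe⟩ := ihA hA.1 hX.1
    obtain ⟨T, hTX, hTB, hTc, hTe⟩ := ihB hA.2.1 hX.2
    exact ⟨S ∪ T, Set.union_subset hSX hTX,
      by simpa [vars] using Set.union_subset_union hSA hTB,
      isClique_web_and_union hA.2.2 hSA hTB hSc hTc,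
      eval_mono Set.subset_union_left hSe, eval_mono Set.subset_union_right hTe⟩

/-- Every clique extends to a satisfying clique. -/
theorem exists_isClique_superset_eval {A : PBF V} (hA : A.Linear) {S : Set V}
    (hS : S ⊆ ↑A.vars) (hc : A.web.IsClique S) :
    ∃ S', S ⊆ S' ∧ S' ⊆ ↑A.vars ∧ A.web.IsClique S' ∧ A.eval S' := by
  induction A generalizing S with
  | var x => exact ⟨{x}, by simpa [vars] using hS, by simp [vars], by simp, by simp [eval]⟩
  | or A B ihA ihB =>
    rcases isClique_web_or_cases hA.2.2 hS hc with ⟨h, hc⟩ | ⟨h, hc⟩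
    · obtain ⟨S', hSS, hSA, hc, he⟩ := ihA hA.1 h hc
      exact ⟨S', hSS, hSA.trans (by simp [vars]), hc.mono fun _ _ h => web_or_adj.2 (.inl h),
        .inl he⟩
    · obtain ⟨S', hSS, hSB, hc, he⟩ := ihB hA.2.1 h hc
      exact ⟨S', hSS, hSB.trans (by simp [vars]), hc.mono fun _ _ h => web_or_adj.2 (.inr h),
        .inr he⟩
  | and A B ihA ihB =>
    obtain ⟨hcA, hcB⟩ := (isClique_web_and_iff hA.2.2 hS).1 hc
    obtain ⟨S₁, h₁, hSA, hSc, hSe⟩ := ihA hA.1 Set.inter_subset_right hcA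
    obtain ⟨S₂, h₂, hTB, hTc, hTe⟩ := ihB hA.2.1 Set.inter_subset_right hcB
    refine ⟨S₁ ∪ S₂, fun x hx => ?_,
      by simpa [vars] using Set.union_subset_union hSA hTB,
      isClique_web_and_union hA.2.2 hSA hTB hSc hTc,
      eval_mono Set.subset_union_left hSe, eval_mono Set.subset_union_right hTe⟩
    have hx' : x ∈ A.vars ∨ x ∈ B.vars := by simpa [vars] using hS hx
    exact hx'.imp (fun h => h₁ ⟨hx, h⟩) fun h => h₂ ⟨hx, h⟩

/-- A satisfying set contained in a clique is the whole clique. -/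
theorem subset_of_isClique_of_eval {A : PBF V} (hA : A.Linear) {S S' : Set V} (h : S ⊆ S')
    (hS' : S' ⊆ ↑A.vars) (hc : A.web.IsClique S') (he : A.eval S) : S' ⊆ S := by
  induction A generalizing S S' with
  | var x =>
    refine hS'.trans ?_
    simpa [vars, eval] using he
  | or A B ihA ihB =>
    have hd := Finset.disjoint_left.1 hA.2.2
    rcases isClique_web_or_cases hA.2.2 hS' hc with ⟨hs, hc⟩ | ⟨hs, hc⟩
    · refine ihA hA.1 h hs hc (he.resolve_right fun he => ?_)
      obtain ⟨x, hxB, hx⟩ := exists_mem_vars_of_eval he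
      exact hd (hs (h hx)) hxB
    · refine ihB hA.2.1 h hs hc (he.resolve_left fun he => ?_)
      obtain ⟨x, hxA, hx⟩ := exists_mem_vars_of_eval he
      exact hd hxA (hs (h hx))
  | and A B ihA ihB =>
    obtain ⟨hcA, hcB⟩ := (isClique_web_and_iff hA.2.2 hS').1 hc
    have h₁ := ihA hA.1 (Set.inter_subset_inter_left _ h) Set.inter_subset_right hcA
      (eval_inter_vars.2 he.1)
    have h₂ := ihB hA.2.1 (Set.inter_subset_inter_left _ h) Set.inter_subset_right hcB
      (eval_inter_vars.2 he.2)
    intro x hx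
    have hx' : x ∈ A.vars ∨ x ∈ B.vars := by simpa [vars] using hS' hx
    exact hx'.elim (fun h => (h₁ ⟨hx, h⟩).1) fun h => (h₂ ⟨hx, h⟩).1

theorem minterm_iff_maxCliqueOn {A : PBF V} (hA : A.Linear) {S : Set V} :
    A.Minterm S ↔ MaxCliqueOn A.web ↑A.vars S := by
  constructor
  · rintro ⟨he, hmin⟩
    obtain ⟨S', hSS, hSA, hc, he'⟩ := exists_subset_of_isClique_of_eval hA he
    obtain rfl := hmin S' hSS he'
    exact ⟨hSA, hc, fun T hT hTc hST => (subset_of_isClique_of_eval hA hST hT hTc he).antisymm hST⟩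
  · rintro ⟨hS, hc, hmax⟩
    obtain ⟨S', hSS, hSA, hc', he⟩ := exists_isClique_superset_eval hA hS hc
    obtain rfl := hmax S' hSA hc' hSS
    exact ⟨he, fun T hT hTe => hT.antisymm (subset_of_isClique_of_eval hA hT hS hc hTe)⟩

end PBF

/-- For a linear formula `A`, the minterms of `A` are exactly the maximal cliques of
its relation web, and the maxterms of `A` are exactly its maximal stable sets. -/
theorem minterm_maxterm_web {V : Type*} [DecidableEq V]
    (A : PBF V) (hA : A.Linear) :
    (∀ S : Set V, A.Minterm S ↔ MaxCliqueOn A.web (↑A.vars) S) ∧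
    (∀ T : Set V, A.Maxterm T ↔ MaxStableOn A.web (↑A.vars) T) := by
  exact ⟨fun _ => PBF.minterm_iff_maxCliqueOn hA, fun _ => PBF.minterm_dual_iff.symm.trans
    ((PBF.minterm_iff_maxCliqueOn hA.dual).trans (PBF.maxCliqueOn_web_dual_iff hA))⟩

end BGL
end

section
/- Modular decomposition (Gallai, prime case): let G be a finite simple graph with at least two vertices such that both G and its complement Ḡ are connected. Then the maximal proper modules of G form a partition of V(G): they are nonempty, pairwise disjoint, and their union is V(G). -/
namespace BGL

variable {V : Type*}

/-- A maximal proper module: a nonempty proper module not properly contained in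
any other proper module. -/
def MaxProperModule (G : SimpleGraph V) (M : Set V) : Prop :=
  M.Nonempty ∧ M ≠ Set.univ ∧ IsModule G M ∧
    ∀ N : Set V, IsModule G N → N ≠ Set.univ → M ⊆ N → N = M

theorem IsModule.union {G : SimpleGraph V} {M N : Set V} (hM : IsModule G M)
    (hN : IsModule G N) (hMN : (M ∩ N).Nonempty) : IsModule G (M ∪ N) := by
  obtain ⟨w, hwM, hwN⟩ := hMN
  have key : ∀ z ∉ M ∪ N, ∀ x ∈ M ∪ N, (G.Adj z x ↔ G.Adj z w) := by
    rintro z hz x (hx | hx)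
    · exact hM z (fun h => hz (Or.inl h)) x hx w hwM
    · exact hN z (fun h => hz (Or.inr h)) x hx w hwN
  intro z hz x hx y hy
  rw [key z hz x hx, key z hz y hy]

theorem isModule_singleton (G : SimpleGraph V) (v : V) : IsModule G {v} := by
  rintro z - x rfl y rfl
  rfl

theorem exists_adj_of_connected {G : SimpleGraph V} (hG : G.Connected) {S : Set V} {a b : V}
    (ha : a ∈ S) (hb : b ∉ S) : ∃ x ∈ S, ∃ y ∉ S, G.Adj x y := by
  obtain ⟨p⟩ := hG.preconnected a b
  obtain ⟨d, -, h₁, h₂⟩ := p.exists_boundary_dart S ha hb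
  exact ⟨d.fst, h₁, d.snd, h₂, d.adj⟩

/-- Two overlapping modules, neither containing the other, cannot cover a connected graph whose
complement is connected. -/
theorem IsModule.union_ne_univ {G : SimpleGraph V} (hG : G.Connected) (hGc : Gᶜ.Connected)
    {M N : Set V} (hM : IsModule G M) (hN : IsModule G N) (hMN : (M ∩ N).Nonempty)
    (h₁ : ¬ M ⊆ N) (h₂ : ¬ N ⊆ M) : M ∪ N ≠ Set.univ := by
  intro hU
  obtain ⟨w, hwM, hwN⟩ := hMN
  obtain ⟨a₀, haM, haN⟩ := Set.not_subset.1 h₁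
  obtain ⟨b, hbN, hbM⟩ := Set.not_subset.1 h₂
  have memM : ∀ a ∉ N, a ∈ M := fun a ha =>
    ((hU ▸ Set.mem_univ a : a ∈ M ∪ N)).resolve_right ha
  have key : ∀ y ∈ N, ∀ a ∉ N, (G.Adj y a ↔ G.Adj b w) := by
    intro y hy a ha
    rw [G.adj_comm, hN a ha y hy b hbN, G.adj_comm]
    exact hM b hbM a (memM a ha) w hwM
  obtain ⟨x, hx, y, hy, hxy⟩ := exists_adj_of_connected hG hwN haN
  obtain ⟨x', hx', y', hy', hxy'⟩ := exists_adj_of_connected hGc hwN haN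
  exact ((G.compl_adj x' y').1 hxy').2 ((key x' hx' y' hy').2 ((key x hx y hy).1 hxy))

theorem MaxProperModule.disjoint {G : SimpleGraph V} (hG : G.Connected) (hGc : Gᶜ.Connected)
    {M N : Set V} (hM : MaxProperModule G M) (hN : MaxProperModule G N) (hne : M ≠ N) :
    Disjoint M N := by
  obtain ⟨-, hMu, hMm, hMmax⟩ := hM
  obtain ⟨-, hNu, hNm, hNmax⟩ := hN
  by_contra hd
  have hMN := Set.not_disjoint_iff_nonempty_inter.1 hd
  have hU := hMm.union_ne_univ hG hGc hNm hMN
    (fun h => hne (hMmax N hNm hNu h).symm) (fun h => hne (hNmax M hMm hMu h))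
  have hU' := hMm.union hNm hMN
  exact hne ((hMmax _ hU' hU Set.subset_union_left).symm.trans
    (hNmax _ hU' hU Set.subset_union_right))

theorem exists_maxProperModule_mem [Finite V] [Nontrivial V] (G : SimpleGraph V) (v : V) :
    ∃ M, MaxProperModule G M ∧ v ∈ M := by
  have hv : IsModule G {v} ∧ ({v} : Set V) ≠ Set.univ :=
    ⟨isModule_singleton G v, Set.singleton_ne_univ v⟩
  obtain ⟨M, hvM, hM⟩ :=
    (Set.toFinite {M : Set V | IsModule G M ∧ M ≠ Set.univ}).exists_le_maximal hv
  have hvM : v ∈ M := hvM rfl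
  exact ⟨M, ⟨⟨v, hvM⟩, hM.prop.2, hM.prop.1, fun N hN hNu hMN =>
    (hM.eq_of_le ⟨hN, hNu⟩ hMN).symm⟩, hvM⟩

/-- Gallai: if `G` and its complement are both connected (and `G` has at least two
vertices), the maximal proper modules partition the vertex set. -/
theorem maxProperModules_partition {V : Type*} [Fintype V] (G : SimpleGraph V)
    (hcard : 2 ≤ Fintype.card V) (hconn : G.Connected) (hcoconn : Gᶜ.Connected) :
    (∀ M : Set V, MaxProperModule G M → M.Nonempty) ∧
    (∀ M N : Set V, MaxProperModule G M → MaxProperModule G N → M ≠ N → Disjoint M N) ∧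
    ⋃₀ {M : Set V | MaxProperModule G M} = Set.univ := by
  have : Nontrivial V := Fintype.one_lt_card_iff_nontrivial.1 hcard
  refine ⟨fun M hM => hM.1, fun M N hM hN => hM.disjoint hconn hcoconn hN, ?_⟩
  refine Set.eq_univ_of_forall fun v => ?_
  obtain ⟨M, hM, hvM⟩ := exists_maxProperModule_mem G v
  exact ⟨M, hM, hvM⟩

end BGL
end

section
/- Maximal cliques and stable sets via modular partitions: let G be a finite simple graph and P a partition of V(G) into nonempty modules. Then for X ⊆ V(G): (1) X is a maximal clique of G if and only if there exist a maximal clique S of the quotient graph G/P and, for each part M ∈ S, a maximal clique S_M of the induced subgraph G↾M, such that X = ⋃_{M∈S} S_M; (2) X is a maximal stable set of G if and only if there exist a maximal stable set T of G/P and, for each M ∈ T, a maximal stable set T_M of G↾M, such that X = ⋃_{M∈T} T_M. -/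
namespace BGL

variable {V : Type*}

theorem isStable_iff_isClique_compl (G : SimpleGraph V) (T : Set V) :
    IsStable G T ↔ Gᶜ.IsClique T := by
  simp only [IsStable, SimpleGraph.IsClique, Set.Pairwise, SimpleGraph.compl_adj]
  grind

theorem maxStable_iff_maxClique_compl (G : SimpleGraph V) (T : Set V) :
    MaxStable G T ↔ MaxClique Gᶜ T := by
  simp only [MaxStable, MaxClique, isStable_iff_isClique_compl]

theorem maxStableOn_iff_maxCliqueOn_compl (G : SimpleGraph V) (U T : Set V) :
    MaxStableOn G U T ↔ MaxCliqueOn Gᶜ U T := by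
  simp only [MaxStableOn, MaxCliqueOn, isStable_iff_isClique_compl]

theorem maxCliqueOn_iff_insert (G : SimpleGraph V) (U S : Set V) :
    MaxCliqueOn G U S ↔
      S ⊆ U ∧ G.IsClique S ∧ ∀ x ∈ U, (∀ y ∈ S, x ≠ y → G.Adj x y) → x ∈ S := by
  refine and_congr_right fun hSU => and_congr_right fun hS => ⟨fun h x hx hxS => ?_, ?_⟩
  · rw [← h (insert x S) (Set.insert_subset hx hSU) (hS.insert hxS) (Set.subset_insert x S)]
    exact Set.mem_insert x S
  · intro h S' hS'U hS' hSS'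
    exact Set.Subset.antisymm
      (fun x hx => h x (hS'U hx) fun y hy hxy => hS' hx (hSS' hy) hxy) hSS'

theorem maxClique_iff_insert (G : SimpleGraph V) (S : Set V) :
    MaxClique G S ↔ G.IsClique S ∧ ∀ x, (∀ y ∈ S, x ≠ y → G.Adj x y) → x ∈ S := by
  simpa [MaxCliqueOn, MaxClique] using maxCliqueOn_iff_insert G Set.univ S

/-- Maximal cliques along a surjection `p` onto a graph `Q` such that adjacency between
vertices in distinct fibres is determined by adjacency in `Q`. -/
theorem maxClique_iff_of_surjective {W : Type*} {G : SimpleGraph V} {Q : SimpleGraph W}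
    {p : V → W} (hp : Function.Surjective p)
    (hadj : ∀ x y, p x ≠ p y → (Q.Adj (p x) (p y) ↔ G.Adj x y)) (X : Set V) :
    MaxClique G X ↔ ∃ S : Set W, MaxClique Q S ∧ ∃ f : W → Set V,
      (∀ w ∈ S, MaxCliqueOn G (p ⁻¹' {w}) (f w)) ∧ X = ⋃ w ∈ S, f w := by
  simp only [maxClique_iff_insert, maxCliqueOn_iff_insert]
  constructor
  · rintro ⟨hX, hmax⟩
    have hS : Q.IsClique (p '' X) := by
      rintro _ ⟨x, hx, rfl⟩ _ ⟨y, hy, rfl⟩ hxy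
      exact (hadj x y hxy).2 (hX hx hy fun h => hxy (congrArg p h))
    refine ⟨p '' X, ⟨hS, fun w hw => ?_⟩, fun w => p ⁻¹' {w} ∩ X, ?_, ?_⟩
    · obtain ⟨x, rfl⟩ := hp w
      by_contra hx
      refine hx ⟨x, hmax x fun y hy _ => ?_, rfl⟩
      have hxy : p x ≠ p y := fun h => hx ⟨y, hy, h.symm⟩
      exact (hadj x y hxy).1 (hw _ ⟨y, hy, rfl⟩ hxy)
    · intro w hw
      refine ⟨Set.inter_subset_left, hX.subset Set.inter_subset_right, ?_⟩
      rintro x rfl hx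
      refine ⟨rfl, hmax x fun y hy hxy => ?_⟩
      by_cases h : p x = p y
      · exact hx y ⟨h.symm, hy⟩ hxy
      · exact (hadj x y h).1 (hS hw ⟨y, hy, rfl⟩ h)
    · ext x
      simp only [Set.mem_iUnion, Set.mem_inter_iff, Set.mem_preimage, Set.mem_singleton_iff]
      exact ⟨fun hx => ⟨p x, ⟨x, hx, rfl⟩, rfl, hx⟩, fun ⟨_, _, _, hx⟩ => hx⟩
  · rintro ⟨S, ⟨hS, hSmax⟩, f, hf, rfl⟩
    have hmem : ∀ {w x}, w ∈ S → x ∈ f w → p x = w := fun hw hx => (hf _ hw).1 hx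
    constructor
    · intro x hx y hy hxy
      simp only [Set.mem_iUnion] at hx hy
      obtain ⟨w, hw, hxw⟩ := hx
      obtain ⟨v, hv, hyv⟩ := hy
      obtain rfl := hmem hw hxw
      obtain rfl := hmem hv hyv
      by_cases h : p x = p y
      · exact (hf _ hw).2.1 hxw (h ▸ hyv) hxy
      · exact (hadj x y h).1 (hS hw hv h)
    · intro x hx
      have hpx : p x ∈ S := by
        refine hSmax _ fun w hw hne => ?_
        obtain ⟨y, hy⟩ : (f w).Nonempty := by
          by_contra hempty
          rw [Set.not_nonempty_iff_eq_empty] at hempty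
          obtain ⟨y, hy⟩ := hp w
          have := (hf w hw).2.2 y hy (by simp [hempty])
          simp [hempty] at this
        obtain rfl := hmem hw hy
        exact (hadj x y hne).2
          (hx y (Set.mem_biUnion hw hy) fun h => hne (congrArg p h))
      exact Set.mem_biUnion hpx
        ((hf _ hpx).2.2 x rfl fun y hy => hx y (Set.mem_biUnion hpx hy))

theorem quotGraph_adj_iff {G : SimpleGraph V} {P : Set (Set V)}
    (hmod : ∀ M ∈ P, IsModule G M) (hdisj : ∀ M ∈ P, ∀ N ∈ P, M ≠ N → Disjoint M N)
    {M N : {M // M ∈ P}} (hne : M ≠ N) {x y : V} (hx : x ∈ M.1) (hy : y ∈ N.1) :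
    (QuotGraph G P).Adj M N ↔ G.Adj x y := by
  have hMN : Disjoint M.1 N.1 := hdisj _ M.2 _ N.2 fun h => hne (Subtype.ext h)
  have key : ∀ a ∈ M.1, ∀ b ∈ N.1, G.Adj a b → G.Adj x y := by
    intro a ha b hb hab
    have hay := (hmod _ N.2 a (hMN.notMem_of_mem_left ha) b hb y hy).1 hab
    exact ((hmod _ M.2 y (hMN.notMem_of_mem_right hy) a ha x hx).1 hay.symm).symm
  simp only [QuotGraph, SimpleGraph.fromRel_adj]
  constructor
  · rintro ⟨_, ⟨a, ha, b, hb, hab⟩ | ⟨b, hb, a, ha, hba⟩⟩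
    · exact key a ha b hb hab
    · exact key a ha b hb hba.symm
  · exact fun h => ⟨hne, Or.inl ⟨x, hx, y, hy, h⟩⟩

/-- Maximal cliques and maximal stable sets via a modular partition. -/
theorem maxClique_maxStable_via_modular_partition {V : Type*} [Fintype V]
    (G : SimpleGraph V) (P : Set (Set V))
    (hP : ∀ M ∈ P, M.Nonempty ∧ IsModule G M)
    (hdisj : ∀ M ∈ P, ∀ N ∈ P, M ≠ N → Disjoint M N)
    (hcover : ⋃₀ P = Set.univ) (X : Set V) :
    (MaxClique G X ↔
      ∃ S : Set {M // M ∈ P}, MaxClique (QuotGraph G P) S ∧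
        ∃ f : {M // M ∈ P} → Set V,
          (∀ M ∈ S, MaxCliqueOn G M.1 (f M)) ∧ X = ⋃ M ∈ S, f M) ∧
    (MaxStable G X ↔
      ∃ T : Set {M // M ∈ P}, MaxStable (QuotGraph G P) T ∧
        ∃ f : {M // M ∈ P} → Set V,
          (∀ M ∈ T, MaxStableOn G M.1 (f M)) ∧ X = ⋃ M ∈ T, f M) := by
  have hex : ∀ x : V, ∃ M : {M // M ∈ P}, x ∈ M.1 := fun x => by
    obtain ⟨M, hM, hx⟩ := Set.mem_sUnion.1 (hcover ▸ Set.mem_univ x)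
    exact ⟨⟨M, hM⟩, hx⟩
  choose p hp using hex
  have hfib : ∀ M : {M // M ∈ P}, p ⁻¹' {M} = M.1 := fun M => by
    ext x
    refine ⟨?_, fun hx => ?_⟩
    · rintro rfl
      exact hp x
    · by_contra h
      exact (hdisj _ (p x).2 _ M.2 fun he => h (Subtype.ext he)).notMem_of_mem_left (hp x) hx
  have hsurj : Function.Surjective p := fun M => by
    obtain ⟨x, hx⟩ := (hP M.1 M.2).1
    rw [← hfib M] at hx
    exact ⟨x, hx⟩
  have hadj : ∀ x y, p x ≠ p y → ((QuotGraph G P).Adj (p x) (p y) ↔ G.Adj x y) :=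
    fun x y h => quotGraph_adj_iff (fun M hM => (hP M hM).2) hdisj h (hp x) (hp y)
  constructor
  · simpa only [hfib] using maxClique_iff_of_surjective hsurj hadj X
  · have hadj' : ∀ x y, p x ≠ p y → ((QuotGraph G P)ᶜ.Adj (p x) (p y) ↔ Gᶜ.Adj x y) := by
      intro x y h
      have hxy : x ≠ y := fun he => h (congrArg p he)
      simp only [SimpleGraph.compl_adj, hadj x y h, h, hxy, ne_eq, not_false_eq_true, true_and]
    simpa only [hfib, maxStable_iff_maxClique_compl, maxStableOn_iff_maxCliqueOn_compl] using
      maxClique_iff_of_surjective hsurj hadj' X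

end BGL
end
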